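/- Let P ∈ ℕ, g ∈ 𝔽_q[t] monic, a ∈ 𝔽_q[t]^R with 0 < |g| ≤ q^P, and β ∈ K_∞^R with |β| < q^{−(d−1)(P−1)}·|g|^{−1}·|m|^{−d}. Then S(a/g + β; P) = q^{nP} · S_g(a) · S_∞(m^d t^{dP} β), where S_g(a) = |g|^{−n} Σ_{|y|<|g|} ψ(a·F(y)/g) and S_∞(γ) = ∫_{𝕋^n} ψ(γ·f(v)) dv. -/

import Mathlib

open scoped Classical NNReal
open Polynomial MeasureTheory

noncomputable section

/-! ## The field `K∞ = 𝔽_q((1/t))`, modelled as formal Laurent series in `τ = t⁻¹` -/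

/-- `t`, as an element of `K∞ = 𝔽_q((τ))` with `τ = t⁻¹`: the Laurent series `single (-1) 1`. -/
def tK (Fq : Type) [Field Fq] : LaurentSeries Fq := HahnSeries.single (-1 : ℤ) 1

/-- The canonical embedding of the polynomial ring `𝔽_q[t]` into `K∞`. -/
def polyToK (Fq : Type) [Field Fq] (p : Polynomial Fq) : LaurentSeries Fq :=
  Polynomial.eval₂ HahnSeries.C (tK Fq) p

/-- The absolute value `|α| = q^{ord α}` on `K∞` (with `|0| = 0`). -/
def absK (Fq : Type) [Field Fq] [Fintype Fq] (α : LaurentSeries Fq) : ℝ≥0 :=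
  if α = 0 then 0 else (Fintype.card Fq : ℝ≥0) ^ (-(HahnSeries.order α))

/-- Sup-absolute value of a vector. -/
def vabs (Fq : Type) [Field Fq] [Fintype Fq] {R : ℕ} (β : Fin R → LaurentSeries Fq) : ℝ≥0 :=
  Finset.univ.sup fun k => absK Fq (β k)

/-- `‖α‖`: the distance from `α` to the ring of polynomials `𝔽_q[t]`;
this equals `|{α}|` where `{α}` is the fractional part of `α`. -/
def distP (Fq : Type) [Field Fq] [Fintype Fq] (α : LaurentSeries Fq) : ℝ≥0 :=
  sInf {r : ℝ≥0 | ∃ b : Polynomial Fq, r = absK Fq (α - polyToK Fq b)}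

/-- The unit ball `𝕋 = {α ∈ K∞ : |α| < 1}`. -/
def TT (Fq : Type) [Field Fq] [Fintype Fq] : Set (LaurentSeries Fq) := {α | absK Fq α < 1}

/-- The unit polydisc `𝕋^n`. -/
def TTn (Fq : Type) [Field Fq] [Fintype Fq] (n : ℕ) : Set (Fin n → LaurentSeries Fq) :=
  {v | ∀ i, absK Fq (v i) < 1}

/-- The standard additive character `ψ` of `K∞`:
`ψ(α) = exp(2πi·tr(a₋₁)/p)` where `a₋₁` is the coefficient of `t⁻¹` in `α`. -/
def psiK (Fq : Type) [Field Fq] [Fintype Fq] (p : ℕ) [CharP Fq p] (α : LaurentSeries Fq) : ℂ :=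
  letI : Algebra (ZMod p) Fq := (ZMod.castHom dvd_rfl Fq).toAlgebra
  Complex.exp (2 * Real.pi * Complex.I *
    ((Algebra.trace (ZMod p) Fq (α.coeff 1)).val : ℂ) / (p : ℂ))

/-- The polynomial with coefficient vector `v`; as `v` ranges over `Fin P → Fq` this
parametrises exactly the polynomials of norm `< q^P`, i.e. of degree `< P`. -/
def polyOf (Fq : Type) [Field Fq] {P : ℕ} (v : Fin P → Fq) : Polynomial Fq :=
  ∑ j : Fin P, Polynomial.C (v j) * Polynomial.X ^ (j : ℕ)

/-! ## Zariski-closed sets, irreducibility, dimension and degree -/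

/-- A Zariski-closed subset of affine `n`-space. -/
def ZarClosed (F : Type) [Field F] (n : ℕ) (S : Set (Fin n → F)) : Prop :=
  ∃ T : Set (MvPolynomial (Fin n) F), S = {x | ∀ f ∈ T, MvPolynomial.eval x f = 0}

/-- Irreducibility of a set with respect to the Zariski topology. -/
def IrredSet (F : Type) [Field F] (n : ℕ) (S : Set (Fin n → F)) : Prop :=
  S.Nonempty ∧ ∀ C₁ C₂ : Set (Fin n → F), ZarClosed F n C₁ → ZarClosed F n C₂ →
    S ⊆ C₁ ∪ C₂ → S ⊆ C₁ ∨ S ⊆ C₂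

/-- Dimension of a subset of affine space: the length of the longest chain of
irreducible Zariski-closed subsets contained in it. -/
def zdim (F : Type) [Field F] (n : ℕ) (S : Set (Fin n → F)) : ℕ :=
  sSup {m : ℕ | ∃ c : Fin (m + 1) → Set (Fin n → F),
    (∀ i, ZarClosed F n (c i) ∧ IrredSet F n (c i) ∧ c i ⊆ S) ∧ StrictMono c}

/-- Degree of an (irreducible) affine variety `S`: the largest (finite) number of points in
which an affine-linear subspace of complementary dimension can meet `S`. -/
def zdeg (F : Type) [Field F] (n : ℕ) (S : Set (Fin n → F)) : ℕ :=
  sSup {m : ℕ | ∃ L : AffineSubspace F (Fin n → F),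
    Module.finrank F L.direction = n - zdim F n S ∧
    (S ∩ (L : Set (Fin n → F))).Finite ∧ (S ∩ (L : Set (Fin n → F))).ncard = m}

/-! ## Smooth complete intersections and counting functions -/

/-- `f₁, …, f_R` are forms of degree `d` cutting out a smooth complete intersection
of codimension `R` in `ℙ^{n-1}`: they are homogeneous of degree `d`, the affine cone has
dimension `n - R`, and the Jacobian matrix has full rank `R` at every nonzero point of the
cone over the algebraic closure. -/
def SmoothCI (Fq : Type) [Field Fq] {n R : ℕ} (d : ℕ)
    (f : Fin R → MvPolynomial (Fin n) Fq) : Prop :=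
  (∀ k, (f k).IsHomogeneous d) ∧
  zdim (AlgebraicClosure Fq) n
      {x : Fin n → AlgebraicClosure Fq | ∀ k, MvPolynomial.aeval x (f k) = 0} = n - R ∧
  ∀ x : Fin n → AlgebraicClosure Fq, x ≠ 0 → (∀ k, MvPolynomial.aeval x (f k) = 0) →
    Matrix.rank (Matrix.of fun (k : Fin R) (i : Fin n) =>
      MvPolynomial.aeval x (MvPolynomial.pderiv i (f k))) = R

/-- The number of `z ∈ 𝔽_q[t]^n` with `|z| < q^D`, satisfying the side condition `extra`,
and with `f_k(z) ≡ 0 (mod g)` for all `k`. -/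
def NsolP (Fq : Type) [Field Fq] {n R : ℕ} (f : Fin R → MvPolynomial (Fin n) Fq)
    (g : Polynomial Fq) (D : ℕ) (extra : (Fin n → Polynomial Fq) → Prop) : ℕ :=
  Nat.card {z : Fin n → Polynomial Fq //
    (∀ i, (z i).degree < (D : WithBot ℕ)) ∧ extra z ∧
    ∀ k, g ∣ MvPolynomial.aeval z (f k)}

/-! ## Exponential sums -/

/-- The exponential sum `S(α; P) = Σ_{|x| < q^P} ψ(α · f(mx + b))`. -/
def Ssum (Fq : Type) [Field Fq] [Fintype Fq] (p : ℕ) [CharP Fq p] {n R : ℕ}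
    (f : Fin R → MvPolynomial (Fin n) Fq) (m : Polynomial Fq) (b : Fin n → Polynomial Fq)
    (α : Fin R → LaurentSeries Fq) (P : ℕ) : ℂ :=
  ∑ x : Fin n → Fin P → Fq,
    psiK Fq p (∑ k, α k *
      polyToK Fq (MvPolynomial.aeval (fun i => m * polyOf Fq (x i) + b i) (f k)))

/-- The complete exponential sum `S_g(a) = |g|^{-n} Σ_{|y| < |g|} ψ(a · f(my + b) / g)`. -/
def SgSum (Fq : Type) [Field Fq] [Fintype Fq] (p : ℕ) [CharP Fq p] {n R : ℕ}
    (f : Fin R → MvPolynomial (Fin n) Fq) (m : Polynomial Fq) (b : Fin n → Polynomial Fq)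
    (g : Polynomial Fq) (a : Fin R → Polynomial Fq) : ℂ :=
  ((Fintype.card Fq : ℂ) ^ (g.natDegree * n))⁻¹ *
    ∑ y : Fin n → Fin g.natDegree → Fq,
      psiK Fq p (∑ k, polyToK Fq (a k) *
        polyToK Fq (MvPolynomial.aeval (fun i => m * polyOf Fq (y i) + b i) (f k)) /
        polyToK Fq g)

/-! ## Forms given by symmetric coefficients, and their multilinear forms -/

/-- Symmetry of a system of degree-`d` coefficients. -/
def SymCoeffs (Fq : Type) [Field Fq] (d n : ℕ) (c : (Fin d → Fin n) → Fq) : Prop :=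
  ∀ (σ : Equiv.Perm (Fin d)) (s : Fin d → Fin n), c (s ∘ σ) = c s

/-- Evaluation of the degree-`d` form with coefficients `c`:
`f(x) = Σ_{i₁,…,i_d} c_{i₁…i_d} x_{i₁} ⋯ x_{i_d}`. -/
def formEval (Fq : Type) [Field Fq] {A : Type} [CommRing A] (d n : ℕ) (φ : Fq →+* A)
    (c : (Fin d → Fin n) → Fq) (x : Fin n → A) : A :=
  ∑ s : Fin d → Fin n, φ (c s) * ∏ j, x (s j)

/-- The `i`-th multilinear form of the form with symmetric coefficients `c`:
`Ψ_i(x^{(1)},…,x^{(d-1)}) = d! Σ c_{i₁…i_{d-1} i} x^{(1)}_{i₁} ⋯ x^{(d-1)}_{i_{d-1}}`. -/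
def psiML (Fq : Type) [Field Fq] {A : Type} [CommRing A] (d n : ℕ) (φ : Fq →+* A)
    (c : (Fin d → Fin n) → Fq) (i : Fin n) (u : Fin (d - 1) → Fin n → A) : A :=
  (Nat.factorial d : A) * ∑ idx : Fin (d - 1) → Fin n,
    φ (c fun j => if h : (j : ℕ) < d - 1 then idx ⟨(j : ℕ), h⟩ else i) * ∏ j, u j (idx j)

/-- The exponential sum `S(α; P)` for the system of forms with coefficients `c`. -/
def SsumC (Fq : Type) [Field Fq] [Fintype Fq] (p : ℕ) [CharP Fq p] (d n R : ℕ)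
    (c : Fin R → (Fin d → Fin n) → Fq) (m : Polynomial Fq) (b : Fin n → Polynomial Fq)
    (α : Fin R → LaurentSeries Fq) (P : ℕ) : ℂ :=
  ∑ x : Fin n → Fin P → Fq,
    psiK Fq p (∑ k, α k * polyToK Fq
      (formEval Fq d n Polynomial.C (c k) fun i => m * polyOf Fq (x i) + b i))

/-! ## The field `F = algebraic closure of 𝔽_q(t)` and the Birch singular loci -/

/-- An algebraically closed field containing `𝔽_q[t]`. -/
abbrev FF (Fq : Type) [Field Fq] : Type := AlgebraicClosure (FractionRing (Polynomial Fq))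

/-- The embedding `𝔽_q[t] → F`. -/
def embPoly (Fq : Type) [Field Fq] : Polynomial Fq →+* FF Fq :=
  (algebraMap (FractionRing (Polynomial Fq)) (FF Fq)).comp
    (algebraMap (Polynomial Fq) (FractionRing (Polynomial Fq)))

/-- The embedding `𝔽_q → F`. -/
def embFq (Fq : Type) [Field Fq] : Fq →+* FF Fq := (embPoly Fq).comp Polynomial.C

/-- `σ_f`: the maximum over nonzero `h ∈ 𝔽_q[t]^R` of the dimension of the locus
`V_{h·f} = {x : h₁∇f₁(x) + ⋯ + h_R ∇f_R(x) = 0}`. -/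
def sigmaF (Fq : Type) [Field Fq] {n R : ℕ} (f : Fin R → MvPolynomial (Fin n) Fq) : ℕ :=
  sSup {s : ℕ | ∃ h : Fin R → Polynomial Fq, h ≠ 0 ∧
    s = zdim (FF Fq) n {x : Fin n → FF Fq | ∀ i : Fin n,
      ∑ k, embPoly Fq (h k) *
        MvPolynomial.eval₂ (embFq Fq) x (MvPolynomial.pderiv i (f k)) = 0}}


section Helpers

/-- `ordGE k α`: all coefficients of `τ^j`, `j < k`, vanish. -/
def ordGE {Fq : Type} [Field Fq] (k : ℤ) (α : LaurentSeries Fq) : Prop := ∀ j < k, α.coeff j = 0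

variable {Fq : Type} [Field Fq]

lemma ordGE_mono {k l : ℤ} (h : l ≤ k) {α : LaurentSeries Fq} (ha : ordGE k α) : ordGE l α :=
  fun j hj => ha j (lt_of_lt_of_le hj h)

lemma ordGE_zero (k : ℤ) : ordGE k (0 : LaurentSeries Fq) := fun j _ => by simp

lemma ordGE_add {k : ℤ} {α β : LaurentSeries Fq} (ha : ordGE k α) (hb : ordGE k β) :
    ordGE k (α + β) := fun j hj => by
  rw [HahnSeries.coeff_add, ha j hj, hb j hj, add_zero]

lemma ordGE_sub {k : ℤ} {α β : LaurentSeries Fq} (ha : ordGE k α) (hb : ordGE k β) :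
    ordGE k (α - β) := fun j hj => by
  rw [HahnSeries.coeff_sub, ha j hj, hb j hj, sub_zero]

lemma ordGE_neg {k : ℤ} {α : LaurentSeries Fq} (ha : ordGE k α) :
    ordGE k (-α) := fun j hj => by
  rw [HahnSeries.coeff_neg, ha j hj, neg_zero]

lemma ordGE_sum {ι : Type*} (s : Finset ι) {k : ℤ} {F : ι → LaurentSeries Fq}
    (h : ∀ i ∈ s, ordGE k (F i)) : ordGE k (∑ i ∈ s, F i) := by
  classical
  induction s using Finset.induction_on with
  | empty => simpa using ordGE_zero k
  | insert a s has ih =>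
    rw [Finset.sum_insert has]
    exact ordGE_add (h a (Finset.mem_insert_self a s))
      (ih fun i hi => h i (Finset.mem_insert_of_mem hi))

lemma ordGE_mul {k l : ℤ} {α β : LaurentSeries Fq} (ha : ordGE k α) (hb : ordGE l β) :
    ordGE (k + l) (α * β) := fun j hj => by
  rw [HahnSeries.coeff_mul]
  refine Finset.sum_eq_zero fun ij hij => ?_
  rw [Finset.mem_antidiagonal] at hij
  rcases lt_or_ge ij.1 k with h | h
  · rw [ha _ h, zero_mul]
  · rw [hb ij.2 (by omega), mul_zero]

lemma ordGE_single (k : ℤ) (a : Fq) : ordGE k (HahnSeries.single k a) := fun j hj => by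
  rw [HahnSeries.coeff_single_of_ne hj.ne]

lemma ordGE_C (a : Fq) : ordGE 0 (HahnSeries.C a : LaurentSeries Fq) := ordGE_single 0 a

lemma single_mul_single' (a b : ℤ) : (HahnSeries.single a (1 : Fq) : LaurentSeries Fq) *
    HahnSeries.single b 1 = HahnSeries.single (a + b) 1 := by
  rw [HahnSeries.single_mul_single, one_mul]

lemma absK_lt_iff [Fintype Fq] (α : LaurentSeries Fq) (k : ℤ) :
    absK Fq α < (Fintype.card Fq : ℝ≥0) ^ k ↔ ordGE (1 - k) α := by
  have hq : (1 : ℝ≥0) < Fintype.card Fq := by exact_mod_cast Fintype.one_lt_card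
  unfold absK
  split_ifs with h
  · subst h
    exact ⟨fun _ => ordGE_zero _, fun _ => zpow_pos (by positivity) _⟩
  · rw [zpow_lt_zpow_iff_right₀ hq]
    constructor
    · intro hk j hj
      exact HahnSeries.coeff_eq_zero_of_lt_order (by omega)
    · intro hk
      by_contra hc
      exact HahnSeries.coeff_order_eq_zero.not.mpr h (hk _ (by omega))

lemma tK_pow (j : ℕ) : tK Fq ^ j = HahnSeries.single (-(j : ℤ)) 1 := by
  rw [tK, HahnSeries.single_pow]; simp

/-- `polyToK` as a ring homomorphism. -/
def polyHom (Fq : Type) [Field Fq] : Polynomial Fq →+* LaurentSeries Fq :=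
  Polynomial.eval₂RingHom HahnSeries.C (tK Fq)

lemma polyToK_eq (p : Polynomial Fq) : polyToK Fq p = polyHom Fq p := rfl

lemma polyHom_coeff (p : Polynomial Fq) (j : ℤ) :
    (polyHom Fq p).coeff j = if j ≤ 0 then p.coeff (-j).toNat else 0 := by
  rw [← polyToK_eq]
  unfold polyToK
  induction p using Polynomial.induction_on' with
  | add p q hp hq =>
    rw [Polynomial.eval₂_add, HahnSeries.coeff_add, hp, hq]
    split_ifs <;> simp
  | monomial n a =>
    rw [Polynomial.eval₂_monomial, tK_pow, HahnSeries.C_apply, HahnSeries.single_mul_single,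
      HahnSeries.coeff_single, Polynomial.coeff_monomial]
    simp only [mul_one, zero_add]
    split_ifs <;> first | rfl | omega

lemma ordGE_poly {p : Polynomial Fq} {N : ℕ} (h : p.degree < (N : WithBot ℕ)) :
    ordGE (1 - N) (polyHom Fq p) := fun j hj => by
  rw [polyHom_coeff]
  split_ifs with h0
  · exact Polynomial.coeff_eq_zero_of_degree_lt (lt_of_lt_of_le h (by exact_mod_cast (by omega)))
  · rfl

lemma polyHom_injective : Function.Injective (polyHom Fq) := by
  rw [injective_iff_map_eq_zero]
  intro p hp
  ext j
  have := polyHom_coeff p (-(j : ℤ))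
  rw [hp] at this
  simpa using this.symm

lemma polyOf_add {P : ℕ} (v w : Fin P → Fq) : polyOf Fq (v + w) = polyOf Fq v + polyOf Fq w := by
  simp [polyOf, add_mul, Finset.sum_add_distrib]

lemma polyOf_coeff {P : ℕ} (v : Fin P → Fq) (j : ℕ) :
    (polyOf Fq v).coeff j = if h : j < P then v ⟨j, h⟩ else 0 := by
  simp only [polyOf, Polynomial.finsetSum_coeff, Polynomial.coeff_C_mul_X_pow]
  split_ifs with h
  · rw [Finset.sum_eq_single ⟨j, h⟩]
    · simp
    · intro b _ hb
      rw [if_neg]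
      intro hj; exact hb (Fin.ext hj.symm)
    · simp
  · refine Finset.sum_eq_zero fun i _ => if_neg ?_
    have := i.2; omega

lemma polyOf_degree {P : ℕ} (v : Fin P → Fq) : (polyOf Fq v).degree < (P : WithBot ℕ) := by
  rw [Polynomial.degree_lt_iff_coeff_zero]
  intro j hj
  rw [polyOf_coeff, dif_neg (by omega)]

lemma polyOf_of_degree {P : ℕ} {p : Polynomial Fq} (h : p.degree < (P : WithBot ℕ)) :
    polyOf Fq (fun j : Fin P => p.coeff j) = p := by
  ext j
  rw [polyOf_coeff]
  split_ifs with hj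
  · rfl
  · exact ((Polynomial.degree_lt_iff_coeff_zero _ _).1 h j (by omega)).symm

lemma psiK_eq [Fintype Fq] (p : ℕ) [Fact p.Prime] [CharP Fq p] (α : LaurentSeries Fq) :
    letI : Algebra (ZMod p) Fq := (ZMod.castHom dvd_rfl Fq).toAlgebra
    psiK Fq p α = (ZMod.toCircle (Algebra.trace (ZMod p) Fq (α.coeff 1)) : ℂ) := by
  rw [ZMod.toCircle_apply]; rfl

lemma psiK_add [Fintype Fq] (p : ℕ) [Fact p.Prime] [CharP Fq p] (α β : LaurentSeries Fq) :
    psiK Fq p (α + β) = psiK Fq p α * psiK Fq p β := by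
  rw [psiK_eq, psiK_eq, psiK_eq, HahnSeries.coeff_add, map_add, AddChar.map_add_eq_mul]
  simp

lemma psiK_congr [Fintype Fq] (p : ℕ) [CharP Fq p] {α β : LaurentSeries Fq}
    (h : (α - β).coeff 1 = 0) : psiK Fq p α = psiK Fq p β := by
  rw [HahnSeries.coeff_sub, sub_eq_zero] at h
  unfold psiK; rw [h]

lemma hom_scale {A : Type*} [CommRing A] (φ : Fq →+* A) {n d : ℕ} {f : MvPolynomial (Fin n) Fq}
    (hf : f.IsHomogeneous d) (c : A) (X : Fin n → A) :
    MvPolynomial.eval₂ φ (fun i => c * X i) f = c ^ d * MvPolynomial.eval₂ φ X f := by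
  rw [MvPolynomial.eval₂_eq', MvPolynomial.eval₂_eq', Finset.mul_sum]
  refine Finset.sum_congr rfl fun s hs => ?_
  have hdeg : ∑ i, s i = d := by
    have := hf (MvPolynomial.mem_support_iff.1 hs)
    rw [← this, Finsupp.weight_apply, Finsupp.sum_fintype] <;> simp
  simp only [mul_pow, Finset.prod_mul_distrib, Finset.prod_pow_eq_pow_sum, hdeg]
  ring

lemma ordGE_eval {n : ℕ} (f : MvPolynomial (Fin n) Fq) {B : ℤ} (X Y : Fin n → LaurentSeries Fq)
    (hX : ∀ i, ordGE 0 (X i)) (hY : ∀ i, ordGE 0 (Y i)) (hXY : ∀ i, ordGE B (X i - Y i)) :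
    ordGE 0 (MvPolynomial.eval₂ HahnSeries.C X f) ∧ ordGE 0 (MvPolynomial.eval₂ HahnSeries.C Y f) ∧
    ordGE B (MvPolynomial.eval₂ HahnSeries.C X f - MvPolynomial.eval₂ HahnSeries.C Y f) := by
  induction f using MvPolynomial.induction_on with
  | C a =>
    simp only [MvPolynomial.eval₂_C, sub_self]
    exact ⟨ordGE_C a, ordGE_C a, ordGE_zero _⟩
  | add p q hp hq =>
    simp only [MvPolynomial.eval₂_add]
    refine ⟨ordGE_add hp.1 hq.1, ordGE_add hp.2.1 hq.2.1, ?_⟩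
    rw [add_sub_add_comm]
    exact ordGE_add hp.2.2 hq.2.2
  | mul_X p i hp =>
    simp only [MvPolynomial.eval₂_mul, MvPolynomial.eval₂_X]
    refine ⟨by simpa using ordGE_mul hp.1 (hX i), by simpa using ordGE_mul hp.2.1 (hY i), ?_⟩
    have e : ∀ u v x y : LaurentSeries Fq, u * x - v * y = u * (x - y) + (u - v) * y := by
      intros; ring
    rw [e]
    refine ordGE_add ?_ ?_
    · simpa using ordGE_mul hp.1 (hXY i)
    · simpa using ordGE_mul hp.2.2 (hY i)

lemma ordGE_form {n d : ℕ} {f : MvPolynomial (Fin n) Fq} (hf : f.IsHomogeneous d)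
    {A B : ℤ} (X Y : Fin n → LaurentSeries Fq)
    (hX : ∀ i, ordGE A (X i)) (hY : ∀ i, ordGE A (Y i)) (hXY : ∀ i, ordGE B (X i - Y i)) :
    ordGE (B + (d - 1) * A)
      (MvPolynomial.eval₂ HahnSeries.C X f - MvPolynomial.eval₂ HahnSeries.C Y f) := by
  have key : ∀ Z : Fin n → LaurentSeries Fq, MvPolynomial.eval₂ HahnSeries.C Z f =
      HahnSeries.single (d * A) 1 *
        MvPolynomial.eval₂ HahnSeries.C (fun i => HahnSeries.single (-A) (1 : Fq) * Z i) f := by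
    intro Z
    rw [hom_scale _ hf, HahnSeries.single_pow, ← mul_assoc, HahnSeries.single_mul_single]
    have : (d : ℤ) * A + d • (-A) = 0 := by simp
    rw [this]; simp
  rw [key X, key Y, ← mul_sub]
  have h := (ordGE_eval f (B := B - A) (fun i => HahnSeries.single (-A) (1 : Fq) * X i)
    (fun i => HahnSeries.single (-A) (1 : Fq) * Y i)
    (fun i => by simpa using ordGE_mul (ordGE_single (-A) (1 : Fq)) (hX i))
    (fun i => by simpa using ordGE_mul (ordGE_single (-A) (1 : Fq)) (hY i))
    (fun i => by
      rw [← mul_sub]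
      exact ordGE_mono (by omega) (ordGE_mul (ordGE_single (-A) (1 : Fq)) (hXY i)))).2.2
  exact ordGE_mono (le_of_eq (by ring)) (ordGE_mul (ordGE_single (d * A) (1 : Fq)) h)

lemma polyToK_aeval {n : ℕ} (Z : Fin n → Polynomial Fq) (f : MvPolynomial (Fin n) Fq) :
    polyToK Fq (MvPolynomial.aeval Z f) =
      MvPolynomial.eval₂ HahnSeries.C (fun i => polyHom Fq (Z i)) f := by
  rw [polyToK_eq, MvPolynomial.aeval_def, MvPolynomial.eval₂_comp_left]
  congr 1
  ext a : 1
  simp [polyHom]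

lemma psi_close [Fintype Fq] (p : ℕ) [CharP Fq p] {n R d : ℕ}
    (f : Fin R → MvPolynomial (Fin n) Fq) (hhom : ∀ k, (f k).IsHomogeneous d)
    (β : Fin R → LaurentSeries Fq) {A B D : ℤ} (hβ : ∀ k, ordGE D (β k))
    (hD : 2 ≤ D + (B + (d - 1) * A)) (X Y : Fin n → LaurentSeries Fq)
    (hX : ∀ i, ordGE A (X i)) (hY : ∀ i, ordGE A (Y i)) (hXY : ∀ i, ordGE B (X i - Y i)) :
    psiK Fq p (∑ k, β k * MvPolynomial.eval₂ HahnSeries.C X (f k)) =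
      psiK Fq p (∑ k, β k * MvPolynomial.eval₂ HahnSeries.C Y (f k)) := by
  apply psiK_congr
  rw [← Finset.sum_sub_distrib]
  refine ordGE_sum (k := 2) _ (fun k _ => ?_) 1 (by norm_num)
  rw [← mul_sub]
  exact ordGE_mono hD (ordGE_mul (hβ k) (ordGE_form (hhom k) X Y hX hY hXY))

lemma average_sum [Fintype Fq] {n P : ℕ} (g : Polynomial Fq) (hg : g.Monic)
    (hgP : g.natDegree ≤ P) (A H : (Fin n → Polynomial Fq) → ℂ)
    (hA : ∀ z w, (∀ i, g ∣ z i - w i) → A z = A w)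
    (hH : ∀ z w : Fin n → Polynomial Fq, (∀ i, (z i).degree < (P : WithBot ℕ)) →
      (∀ i, (w i).degree < (P : WithBot ℕ)) →
      (∀ i, (z i - w i).degree < (g.natDegree : WithBot ℕ)) → H z = H w) :
    (Fintype.card Fq : ℂ) ^ (g.natDegree * n) *
      ∑ x : Fin n → Fin P → Fq, A (fun i => polyOf Fq (x i)) * H (fun i => polyOf Fq (x i)) =
    (∑ y : Fin n → Fin g.natDegree → Fq, A (fun i => polyOf Fq (y i))) *
      ∑ x : Fin n → Fin P → Fq, H (fun i => polyOf Fq (x i)) := by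
  have h1 : ∀ y : Fin n → Fin g.natDegree → Fq,
      ∑ x : Fin n → Fin P → Fq, A (fun i => polyOf Fq (x i)) * H (fun i => polyOf Fq (x i)) =
      ∑ x : Fin n → Fin P → Fq, A (fun i => polyOf Fq (x i) + polyOf Fq (y i)) *
        H (fun i => polyOf Fq (x i)) := by
    intro y
    have hlt : ∀ i, (polyOf Fq (y i)).degree < (P : WithBot ℕ) := fun i =>
      lt_of_lt_of_le (polyOf_degree _) (by exact_mod_cast hgP)
    rw [← Equiv.sum_comp (Equiv.addRight
      (fun i (j : Fin P) => (polyOf Fq (y i)).coeff j : Fin n → Fin P → Fq))]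
    refine Finset.sum_congr rfl fun x _ => ?_
    have e : ∀ i, polyOf Fq ((Equiv.addRight
      (fun i (j : Fin P) => (polyOf Fq (y i)).coeff j : Fin n → Fin P → Fq)) x i) =
        polyOf Fq (x i) + polyOf Fq (y i) := by
      intro i
      simp only [Equiv.coe_addRight, Pi.add_apply]
      rw [polyOf_add, polyOf_of_degree (hlt i)]
    simp only [e]
    congr 1
    apply hH
    · intro i
      exact lt_of_le_of_lt (Polynomial.degree_add_le _ _) (max_lt (polyOf_degree _) (hlt i))
    · intro i; exact polyOf_degree _
    · intro i
      simpa using polyOf_degree (y i)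
  have h2 : ∀ x : Fin n → Fin P → Fq,
      ∑ y : Fin n → Fin g.natDegree → Fq, A (fun i => polyOf Fq (x i) + polyOf Fq (y i)) =
      ∑ y : Fin n → Fin g.natDegree → Fq, A (fun i => polyOf Fq (y i)) := by
    intro x
    have hlt : ∀ i, (polyOf Fq (x i) %ₘ g).degree < (g.natDegree : WithBot ℕ) := fun i => by
      rw [← Polynomial.degree_eq_natDegree hg.ne_zero]
      exact Polynomial.degree_modByMonic_lt _ hg
    rw [← Equiv.sum_comp (Equiv.addRight (fun i (j : Fin g.natDegree) =>
      (polyOf Fq (x i) %ₘ g).coeff j : Fin n → Fin g.natDegree → Fq))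
      (fun y => A (fun i => polyOf Fq (y i)))]
    refine Finset.sum_congr rfl fun y _ => hA _ _ fun i => ?_
    simp only [Equiv.coe_addRight, Pi.add_apply]
    rw [polyOf_add, polyOf_of_degree (hlt i)]
    refine ⟨polyOf Fq (x i) /ₘ g, ?_⟩
    have := Polynomial.modByMonic_add_div (polyOf Fq (x i)) g
    linear_combination -this
  have hcard : (Fintype.card Fq : ℂ) ^ (g.natDegree * n) =
      (Fintype.card (Fin n → Fin g.natDegree → Fq) : ℂ) := by
    simp [pow_mul]
  rw [hcard, ← nsmul_eq_mul, ← Finset.card_univ, ← Finset.sum_const,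
    Finset.sum_congr rfl (fun y _ => h1 y), Finset.sum_comm, Finset.mul_sum]
  refine Finset.sum_congr rfl fun x _ => ?_
  rw [← Finset.sum_mul, h2]

lemma integral_boxes [Fintype Fq] {n : ℕ} [MeasurableSpace (LaurentSeries Fq)]
    (μ : Measure (Fin n → LaurentSeries Fq))
    (hinv : ∀ (a : Fin n → LaurentSeries Fq) (s : Set (Fin n → LaurentSeries Fq)),
      μ ((a + ·) ⁻¹' s) = μ s)
    (hbox : ∀ (c : Fin n → LaurentSeries Fq) (k : ℤ),
      MeasurableSet {v : Fin n → LaurentSeries Fq |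
        ∀ i, absK Fq (v i - c i) < (Fintype.card Fq : ℝ≥0) ^ k})
    (hT : μ (TTn Fq n) = 1) (P : ℕ) (φ : (Fin n → LaurentSeries Fq) → ℂ)
    (h : (Fin n → Polynomial Fq) → ℂ)
    (hφ : ∀ (x : Fin n → Fin P → Fq) (v : Fin n → LaurentSeries Fq),
      (∀ i, ordGE (1 + P) (v i - HahnSeries.single (P : ℤ) 1 * polyHom Fq (polyOf Fq (x i)))) →
        φ v = h (fun i => polyOf Fq (x i))) :
    (Fintype.card Fq : ℂ) ^ (n * P) * ∫ v in TTn Fq n, φ v ∂μ =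
      ∑ x : Fin n → Fin P → Fq, h (fun i => polyOf Fq (x i)) := by
  set c : (Fin n → Fin P → Fq) → Fin n → LaurentSeries Fq := fun x i =>
    HahnSeries.single (P : ℤ) 1 * polyHom Fq (polyOf Fq (x i)) with hc
  set B : (Fin n → Fin P → Fq) → Set (Fin n → LaurentSeries Fq) := fun x =>
    {v | ∀ i, absK Fq (v i - c x i) < (Fintype.card Fq : ℝ≥0) ^ (-(P : ℤ))} with hB
  have memB : ∀ x v, v ∈ B x ↔ ∀ i, ordGE (1 + P) (v i - c x i) := by
    intro x v
    simp only [hB, Set.mem_ofPred_eq, absK_lt_iff, sub_neg_eq_add]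
  have memT : ∀ v, v ∈ TTn Fq n ↔ ∀ i, ordGE 1 (v i) := by
    intro v
    simp only [TTn, Set.mem_ofPred_eq]
    refine forall_congr' fun i => ?_
    rw [← zpow_zero (Fintype.card Fq : ℝ≥0), absK_lt_iff, sub_zero]
  have ccoeff : ∀ x i (j : ℤ), (c x i).coeff j =
      if j ≤ P then (polyOf Fq (x i)).coeff (P - j).toNat else 0 := by
    intro x i j
    have : j = (j - P) + P := by ring
    rw [hc]
    simp only
    rw [this, HahnSeries.coeff_single_mul_add, one_mul, polyHom_coeff]
    simp
  have cover : TTn Fq n = ⋃ x, B x := by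
    ext v
    rw [Set.mem_iUnion, memT]
    constructor
    · intro hv
      obtain ⟨x, hx⟩ : ∃ x : Fin n → Fin P → Fq, ∀ i (j : Fin P),
          x i j = (v i).coeff ((P : ℤ) - ((j : ℕ) : ℤ)) := ⟨fun i j => _, fun i j => rfl⟩
      refine ⟨x, (memB _ _).2 fun i j hj => ?_⟩
      rw [HahnSeries.coeff_sub, ccoeff, if_pos (by omega), polyOf_coeff]
      split_ifs with hlt
      · rw [hx, sub_eq_zero]; congr 1; simp only; omega
      · rw [hv i j (by omega), sub_zero]
    · rintro ⟨x, hx⟩ i j hj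
      have h1 := (memB _ _).1 hx i j (by omega)
      rw [HahnSeries.coeff_sub, ccoeff, if_pos (by omega), polyOf_coeff,
        dif_neg (by omega), sub_zero] at h1
      exact h1
  have disj : Pairwise (Function.onFun Disjoint B) := by
    intro x y hxy
    rw [Function.onFun, Set.disjoint_left]
    intro v hx hy
    apply hxy
    funext i j
    have h1 := (memB _ _).1 hx i (P - j) (by omega)
    have h2 := (memB _ _).1 hy i (P - j) (by omega)
    rw [HahnSeries.coeff_sub, ccoeff, if_pos (by omega), polyOf_coeff,
        dif_pos (by omega), sub_eq_zero] at h1 h2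
    have h3 := h1.symm.trans h2
    convert! h3 using 2 <;> (apply Fin.ext; simp)
  have meas : ∀ x, MeasurableSet (B x) := fun x => hbox _ _
  have hμ : ∀ x, μ (B x) = μ (B 0) := by
    intro x
    rw [← hinv (c x - c 0) (B x)]
    congr 1
    ext v
    rw [Set.mem_preimage, memB, memB]
    refine forall_congr' fun i => ?_
    simp only [Pi.add_apply, Pi.sub_apply]
    rw [show c x i - c 0 i + v i - c x i = v i - c 0 i by ring]
  have hreal : (Fintype.card Fq : ℝ) ^ (n * P) * μ.real (B 0) = 1 := by
    have h1 := hT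
    rw [cover, measure_iUnion disj meas, tsum_fintype, Finset.sum_congr rfl (fun x _ => hμ x),
      Finset.sum_const, nsmul_eq_mul] at h1
    have h2 := congrArg ENNReal.toReal h1
    rw [ENNReal.toReal_mul] at h2
    simp only [Finset.card_univ, Fintype.card_fun, Fintype.card_fin, ENNReal.toReal_one,
      ENNReal.toReal_natCast] at h2
    rw [← h2, Measure.real]
    push_cast
    rw [← pow_mul, mul_comm n P]
  have hfin : ∀ x, μ (B x) ≠ ⊤ := by
    intro x
    have : μ (B x) ≤ 1 := by
      rw [← hT, cover]; exact measure_mono (Set.subset_iUnion B x)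
    exact ne_top_of_le_ne_top ENNReal.one_ne_top this
  have heq : ∀ x, Set.EqOn (fun _ => h (fun i => polyOf Fq (x i))) φ (B x) := fun x v hv =>
    (hφ x v ((memB _ _).1 hv)).symm
  have hinteg : ∀ x, IntegrableOn φ (B x) μ := fun x =>
    IntegrableOn.congr_fun (integrableOn_const (hfin x)) (heq x) (meas x)
  rw [cover, integral_iUnion_fintype meas disj hinteg, Finset.mul_sum]
  refine Finset.sum_congr rfl fun x _ => ?_
  rw [← setIntegral_congr_fun (meas x) (heq x), setIntegral_const, Measure.real, hμ x,
    Complex.real_smul, ← mul_assoc]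
  have := congrArg (fun r : ℝ => (r : ℂ)) hreal
  simp only [Measure.real] at this
  push_cast at this
  rw [this, one_mul]

end Helpers

/-- Lemma 4.6, major-arc factorisation:
`S(a/g + β; P) = q^{nP} S_g(a) S_∞(m^d t^{dP} β)`. -/
theorem statement14 (Fq : Type) [Field Fq] [Fintype Fq] (p d n R : ℕ)
    [Fact p.Prime] [CharP Fq p] (hd : 2 ≤ d) (hdp : d < p)
    (f : Fin R → MvPolynomial (Fin n) Fq) (hhom : ∀ k, (f k).IsHomogeneous d)
    (m : Polynomial Fq) (hm : m ≠ 0)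
    (b : Fin n → Polynomial Fq) (hb : ∀ i, (b i).degree < (m.natDegree : WithBot ℕ))
    [MeasurableSpace (LaurentSeries Fq)]
    (μ : Measure (Fin n → LaurentSeries Fq))
    (hinv : ∀ (a : Fin n → LaurentSeries Fq) (s : Set (Fin n → LaurentSeries Fq)),
      μ ((a + ·) ⁻¹' s) = μ s)
    (hbox : ∀ (c : Fin n → LaurentSeries Fq) (k : ℤ),
      MeasurableSet {v : Fin n → LaurentSeries Fq |
        ∀ i, absK Fq (v i - c i) < (Fintype.card Fq : ℝ≥0) ^ k})
    (hT : μ (TTn Fq n) = 1)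
    (P : ℕ) (hP : 1 ≤ P)
    (g : Polynomial Fq) (hg : g.Monic) (hgP : g.natDegree ≤ P)
    (a : Fin R → Polynomial Fq)
    (β : Fin R → LaurentSeries Fq)
    (hβ : vabs Fq β < (Fintype.card Fq : ℝ≥0) ^
        (-(((d : ℤ) - 1) * ((P : ℤ) - 1)) - (g.natDegree : ℤ) - (d : ℤ) * m.natDegree)) :
    Ssum Fq p f m b (fun k => polyToK Fq (a k) / polyToK Fq g + β k) P
      = (Fintype.card Fq : ℂ) ^ (n * P) * SgSum Fq p f m b g a *
          ∫ v in TTn Fq n,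
            psiK Fq p (∑ k, (polyToK Fq (m ^ d) * (tK Fq) ^ (d * P) * β k) *
              MvPolynomial.eval₂ HahnSeries.C v (f k)) ∂μ := by

  have hβ' : ∀ k, ordGE (1 + (((d : ℤ) - 1) * ((P : ℤ) - 1)) + (g.natDegree : ℤ) +
      (d : ℤ) * m.natDegree) (β k) := by
    intro k
    have h1 : absK Fq (β k) ≤ vabs Fq β :=
      Finset.le_sup (f := fun k => absK Fq (β k)) (Finset.mem_univ k)
    exact ordGE_mono (by linarith) ((absK_lt_iff _ _).1 (lt_of_le_of_lt h1 hβ))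
  set M : ℤ := (m.natDegree : ℤ) with hM
  set G : ℤ := (g.natDegree : ℤ) with hG
  have hGP : G ≤ P := by omega
  have hmO : ordGE (-M) (polyHom Fq m) :=
    ordGE_mono (by push_cast; omega) (ordGE_poly (N := m.natDegree + 1)
      (lt_of_le_of_lt Polynomial.degree_le_natDegree
        (by exact_mod_cast Nat.lt_succ_self m.natDegree)))
  have hbO : ∀ i, ordGE (1 - M) (polyHom Fq (b i)) := fun i => ordGE_poly (hb i)
  have hG0 : 0 ≤ G := by omega
  have close := psi_close p f hhom β (A := -(M + P - 1)) (B := -(M + G - 1)) hβ'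
    (le_of_eq (by ring))
  have hsize : ∀ (z c : Polynomial Fq), z.degree < (P : WithBot ℕ) →
      c.degree < (m.natDegree : WithBot ℕ) →
      ordGE (-(M + P - 1)) (polyHom Fq (m * z + c)) := by
    intro z c hz hc
    rw [map_add, map_mul]
    exact ordGE_add (ordGE_mono (by omega) (ordGE_mul hmO (ordGE_poly hz)))
      (ordGE_mono (by omega) (ordGE_poly hc))
  set A : (Fin n → Polynomial Fq) → ℂ := fun z => psiK Fq p (∑ k, polyToK Fq (a k) *
    polyToK Fq (MvPolynomial.aeval (fun i => m * z i + b i) (f k)) / polyToK Fq g) with hAdef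
  set H : (Fin n → Polynomial Fq) → ℂ := fun z => psiK Fq p (∑ k, β k *
    MvPolynomial.eval₂ HahnSeries.C (fun i => polyHom Fq (m * z i + b i)) (f k)) with hHdef
  have hg0 : polyHom Fq g ≠ 0 := (map_ne_zero_iff _ polyHom_injective).2 hg.ne_zero
  have hA : ∀ z w, (∀ i, g ∣ z i - w i) → A z = A w := by
    intro z w hzw
    apply psiK_congr
    have hdiv : ∀ k, ∃ e : Polynomial Fq,
        MvPolynomial.aeval (fun i => m * z i + b i) (f k) -
          MvPolynomial.aeval (fun i => m * w i + b i) (f k) = g * e := by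
      intro k
      change g ∣ _
      rw [← Ideal.mem_span_singleton, ← Ideal.Quotient.eq]
      simp only [MvPolynomial.aeval_def]
      rw [MvPolynomial.eval₂_comp_left, MvPolynomial.eval₂_comp_left]
      congr 1
      funext i
      simp only [Function.comp_apply]
      rw [Ideal.Quotient.eq, Ideal.mem_span_singleton]
      obtain ⟨e, he⟩ := hzw i
      exact ⟨m * e, by linear_combination m * he⟩
    choose e he using hdiv
    have : (∑ k, polyToK Fq (a k) *
        polyToK Fq (MvPolynomial.aeval (fun i => m * z i + b i) (f k)) / polyToK Fq g) -
        (∑ k, polyToK Fq (a k) *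
        polyToK Fq (MvPolynomial.aeval (fun i => m * w i + b i) (f k)) / polyToK Fq g) =
        polyHom Fq (∑ k, a k * e k) := by
      rw [← Finset.sum_sub_distrib, map_sum]
      refine Finset.sum_congr rfl fun k _ => ?_
      simp only [polyToK_eq]
      have h1 := congrArg (polyHom Fq) (he k)
      rw [map_sub, map_mul] at h1
      rw [map_mul, ← sub_div, ← mul_sub, h1]
      field_simp
    rw [this, polyHom_coeff, if_neg (by norm_num)]
  have hH : ∀ z w : Fin n → Polynomial Fq, (∀ i, (z i).degree < (P : WithBot ℕ)) →
      (∀ i, (w i).degree < (P : WithBot ℕ)) →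
      (∀ i, (z i - w i).degree < (g.natDegree : WithBot ℕ)) → H z = H w := by
    intro z w hz hw hzw
    refine close _ _ (fun i => hsize _ _ (hz i) (hb i)) (fun i => hsize _ _ (hw i) (hb i))
      fun i => ?_
    rw [← map_sub, show m * z i + b i - (m * w i + b i) = m * (z i - w i) by ring, map_mul]
    exact ordGE_mono (by omega) (ordGE_mul hmO (ordGE_poly (hzw i)))
  have hsum := average_sum g hg hgP A H hA hH
  have hinteg := integral_boxes μ hinv hbox hT P
    (fun v => psiK Fq p (∑ k, (polyToK Fq (m ^ d) * (tK Fq) ^ (d * P) * β k) *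
              MvPolynomial.eval₂ HahnSeries.C v (f k))) H (by
    intro x v hv
    have e : ∀ k, (polyToK Fq (m ^ d) * (tK Fq) ^ (d * P) * β k) *
        MvPolynomial.eval₂ HahnSeries.C v (f k) = β k * MvPolynomial.eval₂ HahnSeries.C
          (fun i => (polyHom Fq m * tK Fq ^ P) * v i) (f k) := by
      intro k
      rw [hom_scale _ (hhom k), polyToK_eq, map_pow, mul_comm d P, pow_mul]
      ring
    simp only [e]
    have hdiff : ∀ i, ordGE (1 - M) ((polyHom Fq m * tK Fq ^ P) * v i -
        polyHom Fq (m * polyOf Fq (x i))) := by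
      intro i
      have h1 : (polyHom Fq m * tK Fq ^ P) * v i - polyHom Fq (m * polyOf Fq (x i)) =
          polyHom Fq m * (tK Fq ^ P * (v i -
            HahnSeries.single (P : ℤ) 1 * polyHom Fq (polyOf Fq (x i)))) := by
        have h2 : tK Fq ^ P * HahnSeries.single (P : ℤ) 1 = 1 := by
          rw [tK_pow, single_mul_single', neg_add_cancel]; rfl
        rw [map_mul]
        linear_combination (polyHom Fq m * polyHom Fq (polyOf Fq (x i))) * h2
      rw [h1, tK_pow]
      exact ordGE_mono (by omega) (ordGE_mul hmO (ordGE_mul (ordGE_single _ _) (hv i)))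
    have hB : ∀ i, ordGE (1 - M) ((polyHom Fq m * tK Fq ^ P) * v i -
        polyHom Fq (m * polyOf Fq (x i) + b i)) := by
      intro i
      rw [map_add, ← sub_sub]
      exact ordGE_sub (hdiff i) (hbO i)
    refine close _ _ (fun i => ?_) (fun i => hsize _ _ (polyOf_degree _) (hb i))
      fun i => ordGE_mono (by omega) (hB i)
    have h3 := ordGE_add (ordGE_mono (show -(M + P - 1) ≤ 1 - M by omega) (hB i))
      (hsize _ _ (polyOf_degree (x i)) (hb i))
    rwa [sub_add_cancel] at h3)
  have hS : Ssum Fq p f m b (fun k => polyToK Fq (a k) / polyToK Fq g + β k) P =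
      ∑ x : Fin n → Fin P → Fq, A (fun i => polyOf Fq (x i)) * H (fun i => polyOf Fq (x i)) := by
    unfold Ssum
    refine Finset.sum_congr rfl fun x _ => ?_
    rw [hAdef, hHdef]
    simp only
    rw [← psiK_add, ← Finset.sum_add_distrib]
    congr 1
    refine Finset.sum_congr rfl fun k _ => ?_
    rw [← polyToK_aeval]
    ring
  have hq : (Fintype.card Fq : ℂ) ^ (g.natDegree * n) ≠ 0 := by
    apply pow_ne_zero
    exact_mod_cast Fintype.card_ne_zero
  rw [hS, mul_right_comm, hinteg]
  unfold SgSum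
  change _ = _ * (_ * ∑ y : Fin n → Fin g.natDegree → Fq, A (fun i => polyOf Fq (y i)))
  rw [mul_left_comm, mul_comm (∑ x : Fin n → Fin P → Fq, H (fun i => polyOf Fq (x i))), ← hsum,
    inv_mul_cancel_left₀ hq]
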